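/- Let d ≥ 1 and β ≥ 1 be integers, L > 0 and M ≥ 0. If f ∈ S_L^p(β), then the bias of the rank-M projection satisfies ‖f − f_M‖² ≤ (L² / (2π)^{2β}) · (M+1)^{−2β}, where f_M is the orthogonal projection of f onto span{φ_k : k ∈ {−M,…,M}^d} and ‖·‖ is the L²([0,1]^d) norm. -/

import Mathlib

open MeasureTheory ProbabilityTheory Real Complex Finset

noncomputable section

def cube (d : ℕ) : Set (Fin d → ℝ) := Set.Icc 0 1

def phi (d : ℕ) (k : Fin d → ℤ) (x : Fin d → ℝ) : ℂ :=
  Complex.exp (Complex.I * (2 * Real.pi) * ∑ i, (k i : ℂ) * (x i : ℂ))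

def fCoeff (d : ℕ) (g : (Fin d → ℝ) → ℂ) (k : Fin d → ℤ) : ℂ :=
  ∫ x in cube d, g x * (starRingEnd ℂ) (phi d k x)

def box (d M : ℕ) : Finset (Fin d → ℤ) :=
  Fintype.piFinset fun _ => Finset.Icc (-(M : ℤ)) (M : ℤ)

/-- Orthogonal projection of `g` onto `span{φ_k : k ∈ {-M,…,M}^d}` (its Fourier
partial sum). -/
def projM (d M : ℕ) (g : (Fin d → ℝ) → ℂ) : (Fin d → ℝ) → ℂ :=
  fun x => ∑ k ∈ box d M, fCoeff d g k * phi d k x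

/-- Squared `L²([0,1]^d)` norm. -/
def l2sq (d : ℕ) (g : (Fin d → ℝ) → ℂ) : ℝ :=
  ∫ x in cube d, ‖g x‖ ^ 2

/-- Partial derivative in the `i`-th coordinate direction. -/
def pderiv (d : ℕ) (i : Fin d) (g : (Fin d → ℝ) → ℝ) : (Fin d → ℝ) → ℝ :=
  fun x => deriv (fun t => g (Function.update x i t)) (x i)

/-- Iterated partial derivative `∂^α g` for the multi-index `α`. -/
def mderiv (d : ℕ) (α : Fin d → ℕ) (g : (Fin d → ℝ) → ℝ) : (Fin d → ℝ) → ℝ :=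
  (List.finRange d).foldr (fun i h => (pderiv d i)^[α i] h) g

/-- The finite set of multi-indices `α ∈ ℕ^d` with `|α| = β`. -/
def multiIdx (d β : ℕ) : Finset (Fin d → ℕ) :=
  (Fintype.piFinset fun _ : Fin d => Finset.range (β + 1)).filter fun α => ∑ i, α i = β

/-- The periodic Sobolev ball `S_L^p(β)` of integer smoothness `β`: `f` is `β` times
continuously differentiable, the total energy of the `β`-th derivatives is at most `L²`,
and all derivatives of order `< β` (including `f` itself) satisfy the periodic boundary
condition on `[0,1]^d`. -/
def SobolevP (d β : ℕ) (L : ℝ) (f : (Fin d → ℝ) → ℝ) : Prop :=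
  ContDiff ℝ (β : ℕ∞) f ∧
  (∑ α ∈ multiIdx d β, ∫ x in cube d, (mderiv d α f x) ^ 2) ≤ L ^ 2 ∧
  ∀ α : Fin d → ℕ, (∑ i, α i) < β →
    ∀ x ∈ cube d, ∀ i : Fin d, (x i = 0 ∨ x i = 1) →
      mderiv d α f x = mderiv d α f (Function.update x i (1 - x i))

section FourierCube

local instance : MeasureSpace UnitAddCircle := ⟨AddCircle.haarAddCircle⟩

local instance : IsProbabilityMeasure (volume : Measure UnitAddCircle) :=
  inferInstanceAs (IsProbabilityMeasure AddCircle.haarAddCircle)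

/-- The representative in `(0,1]^d` of a point of the torus. -/
def torusRep (d : ℕ) (t : UnitAddTorus (Fin d)) : Fin d → ℝ :=
  fun i => (AddCircle.equivIoc 1 0 (t i)).1

lemma measurable_torusRep (d : ℕ) : Measurable (torusRep d) :=
  measurable_subtype_coe.comp
    (UnitAddTorus.measurableEquivPiIoc (fun _ : Fin d => (0 : ℝ))).measurable

lemma torusRep_mem_cube (d : ℕ) (t : UnitAddTorus (Fin d)) : torusRep d t ∈ cube d := by
  refine Set.mem_Icc.2 ⟨fun i => ?_, fun i => ?_⟩
  · exact (AddCircle.equivIoc 1 0 (t i)).2.1.le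
  · exact (AddCircle.equivIoc 1 0 (t i)).2.2.trans_eq (zero_add 1)

lemma coe_torusRep {d : ℕ} (t : UnitAddTorus (Fin d)) :
    (fun i => (torusRep d t i : UnitAddCircle)) = t :=
  funext fun _ => AddCircle.coe_equivIoc

lemma integral_comp_torusRep {E : Type*} [NormedAddCommGroup E] [NormedSpace ℝ E] (d : ℕ)
    (h : (Fin d → ℝ) → E) :
    ∫ t : UnitAddTorus (Fin d), h (torusRep d t) = ∫ x in cube d, h x := by
  rw [UnitAddTorus.integral_preimage _ (fun _ => (0 : ℝ))]
  have hset : {x : Fin d → ℝ | ∀ i, x i ∈ Set.Ioc (0 : ℝ) (0 + 1)}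
      = Set.univ.pi fun i => Set.Ioc ((0 : Fin d → ℝ) i) ((1 : Fin d → ℝ) i) := by
    ext x; simp
  rw [hset, cube, volume_pi, ← setIntegral_congr_set Measure.univ_pi_Ioc_ae_eq_Icc]
  refine setIntegral_congr_fun (MeasurableSet.univ_pi fun _ => measurableSet_Ioc) fun x hx => ?_
  congr 1
  funext i
  have hi : x i ∈ Set.Ioc (0 : ℝ) (0 + 1) := by simpa using hx i trivial
  exact AddCircle.equivIoc_coe_of_mem hi

lemma mFourier_coe (d : ℕ) (k : Fin d → ℤ) (x : Fin d → ℝ) :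
    UnitAddTorus.mFourier k (fun i => (x i : UnitAddCircle)) = phi d k x := by
  simp only [UnitAddTorus.mFourier, ContinuousMap.coe_mk, fourier_coe_apply, phi, Finset.mul_sum,
    Complex.exp_sum]
  refine Finset.prod_congr rfl fun i _ => ?_
  congr 1
  push_cast
  ring

lemma mFourier_eq_phi_torusRep {d : ℕ} (k : Fin d → ℤ) (t : UnitAddTorus (Fin d)) :
    UnitAddTorus.mFourier k t = phi d k (torusRep d t) := by
  rw [← mFourier_coe, coe_torusRep]

lemma mFourierCoeff_comp_torusRep {d : ℕ} (g : (Fin d → ℝ) → ℂ) (k : Fin d → ℤ) :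
    UnitAddTorus.mFourierCoeff (fun t => g (torusRep d t)) k = fCoeff d g k := by
  rw [fCoeff, ← integral_comp_torusRep, UnitAddTorus.mFourierCoeff]
  refine integral_congr_ae (.of_forall fun t => ?_)
  simp only [UnitAddTorus.mFourier_neg, smul_eq_mul, mFourier_eq_phi_torusRep, mul_comm]

/-- **Parseval's identity** on the unit cube. -/
lemma hasSum_sq_fCoeff {d : ℕ} {g : (Fin d → ℝ) → ℂ} (hg : Continuous g) :
    HasSum (fun k => ‖fCoeff d g k‖ ^ 2) (l2sq d g) := by
  obtain ⟨C, hC⟩ := (isCompact_Icc (a := (0 : Fin d → ℝ)) (b := 1)).exists_bound_of_continuousOn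
    hg.continuousOn
  have hL : MemLp (fun t => g (torusRep d t)) 2 (volume : Measure (UnitAddTorus (Fin d))) :=
    .of_bound (hg.measurable.comp (measurable_torusRep d)).aestronglyMeasurable C
      (.of_forall fun t => hC _ (torusRep_mem_cube d t))
  convert UnitAddTorus.hasSum_sq_mFourierCoeff hL.toLp using 1
  · funext k
    rw [← mFourierCoeff_comp_torusRep, UnitAddTorus.mFourierCoeff, UnitAddTorus.mFourierCoeff]
    congr 2
    refine integral_congr_ae ?_
    filter_upwards [hL.coeFn_toLp] with t ht
    rw [ht]
  · rw [l2sq, ← integral_comp_torusRep]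
    refine integral_congr_ae ?_
    filter_upwards [hL.coeFn_toLp] with t ht
    rw [ht]

lemma fCoeff_phi (d : ℕ) (j k : Fin d → ℤ) : fCoeff d (phi d j) k = if k = j then 1 else 0 := by
  rw [← orthonormal_iff_ite.1 UnitAddTorus.orthonormal_mFourier k j, ContinuousMap.inner_toLp,
    fCoeff, ← integral_comp_torusRep]
  refine integral_congr_ae (.of_forall fun t => ?_)
  simp only [mFourier_eq_phi_torusRep]

end FourierCube

lemma continuous_phi (d : ℕ) (k : Fin d → ℤ) : Continuous (phi d k) := by
  unfold phi; fun_prop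

lemma integrableOn_mul_conj_phi {d : ℕ} {g : (Fin d → ℝ) → ℂ} (hg : Continuous g)
    (k : Fin d → ℤ) : IntegrableOn (fun x => g x * (starRingEnd ℂ) (phi d k x)) (cube d) :=
  (hg.mul (Complex.continuous_conj.comp (continuous_phi d k))).continuousOn.integrableOn_compact
    isCompact_Icc

lemma continuous_projM (d M : ℕ) (g : (Fin d → ℝ) → ℂ) : Continuous (projM d M g) :=
  continuous_finsetSum _ fun k _ => continuous_const.mul (continuous_phi d k)

lemma fCoeff_projM (d M : ℕ) (g : (Fin d → ℝ) → ℂ) (k : Fin d → ℤ) :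
    fCoeff d (projM d M g) k = if k ∈ box d M then fCoeff d g k else 0 := by
  have h : fCoeff d (projM d M g) k
      = ∑ j ∈ box d M, fCoeff d g j * fCoeff d (phi d j) k := by
    simp only [fCoeff, projM, Finset.sum_mul, mul_assoc]
    rw [integral_finsetSum]
    · simp only [integral_const_mul]
    · exact fun j _ => (integrableOn_mul_conj_phi (continuous_phi d j) k).const_mul _
  simp [h, fCoeff_phi]

lemma fCoeff_sub {d : ℕ} {g h : (Fin d → ℝ) → ℂ} (hg : Continuous g) (hh : Continuous h)
    (k : Fin d → ℤ) : fCoeff d (fun x => g x - h x) k = fCoeff d g k - fCoeff d h k := by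
  simp only [fCoeff, sub_mul]
  exact integral_sub (integrableOn_mul_conj_phi hg k) (integrableOn_mul_conj_phi hh k)

lemma fCoeff_sub_projM {d : ℕ} {g : (Fin d → ℝ) → ℂ} (hg : Continuous g) (M : ℕ)
    (k : Fin d → ℤ) :
    fCoeff d (fun x => g x - projM d M g x) k = if k ∈ box d M then 0 else fCoeff d g k := by
  rw [fCoeff_sub hg (continuous_projM d M g), fCoeff_projM]
  split_ifs <;> simp

lemma phi_update {d : ℕ} (k : Fin d → ℤ) (y : Fin d → ℝ) (j : Fin d) (t : ℝ) :
    phi d k (Function.update y j t)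
      = phi d k y * Complex.exp (2 * Real.pi * Complex.I * k j * (t - y j)) := by
  have h : ∑ i, (k i : ℂ) * ((Function.update y j t i : ℝ) : ℂ)
      = ∑ i, (k i : ℂ) * (y i : ℂ) + k j * (t - y j) := by
    rw [← sub_eq_iff_eq_add', ← Finset.sum_sub_distrib, Finset.sum_eq_single j]
    · simp [mul_sub]
    · intro i _ hij
      simp [hij]
    · simp
  rw [phi, phi, h, ← Complex.exp_add]
  congr 1
  ring

lemma phi_update_one {d : ℕ} (k : Fin d → ℤ) (y : Fin d → ℝ) (j : Fin d) :
    phi d k (Function.update y j 1) = phi d k (Function.update y j 0) := by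
  have h := phi_update k (Function.update y j 0) j 1
  rw [Function.update_idem, Function.update_self] at h
  rw [h, Complex.ofReal_one, Complex.ofReal_zero, sub_zero, mul_one,
    mul_comm _ ((k j : ℤ) : ℂ), Complex.exp_int_mul_two_pi_mul_I, mul_one]

lemma hasDerivAt_phi_update {d : ℕ} (k : Fin d → ℤ) (x : Fin d → ℝ) (j : Fin d) :
    HasDerivAt (fun t => phi d k (Function.update x j t))
      (2 * Real.pi * Complex.I * k j * phi d k x) (x j) := by
  simp only [phi_update]
  have h : HasDerivAt (fun t : ℝ => 2 * Real.pi * Complex.I * k j * ((t : ℂ) - x j))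
      (2 * Real.pi * Complex.I * k j * 1) (x j) :=
    ((hasDerivAt_id (x j)).ofReal_comp.sub_const _).const_mul _
  refine (h.cexp.const_mul (phi d k x)).congr_deriv ?_
  rw [sub_self, mul_zero, Complex.exp_zero]
  ring

section Derivatives

variable {d : ℕ}

lemma HasFDerivAt.hasDerivAt_update {E : Type*} [NormedAddCommGroup E] [NormedSpace ℝ E]
    {g : (Fin d → ℝ) → E} {g' : (Fin d → ℝ) →L[ℝ] E} {x : Fin d → ℝ} (hg : HasFDerivAt g g' x)
    (j : Fin d) :
    HasDerivAt (fun t => g (Function.update x j t)) (g' (Pi.single j 1)) (x j) := by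
  refine HasFDerivAt.comp_hasDerivAt (x j) ?_ (_root_.hasDerivAt_update x j (x j))
  simpa using hg

lemma pderiv_eq_fderiv {g : (Fin d → ℝ) → ℝ} (hg : Differentiable ℝ g) (j : Fin d) :
    pderiv d j g = fun x => fderiv ℝ g x (Pi.single j 1) :=
  funext fun x => ((hg x).hasFDerivAt.hasDerivAt_update j).deriv

lemma ContDiff.pderiv {g : (Fin d → ℝ) → ℝ} {n : ℕ} (hg : ContDiff ℝ (n + 1 : ℕ) g) (j : Fin d) :
    ContDiff ℝ n (pderiv d j g) := by
  rw [pderiv_eq_fderiv (hg.differentiable (by simp))]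
  exact (hg.fderiv_right (by norm_cast)).clm_apply contDiff_const

lemma ContDiff.iterate_pderiv {g : (Fin d → ℝ) → ℝ} {n m : ℕ} (hg : ContDiff ℝ (n + m : ℕ) g)
    (j : Fin d) : ContDiff ℝ n ((_root_.pderiv d j)^[m] g) := by
  induction m generalizing g with
  | zero => simpa using hg
  | succ m ih =>
    rw [Function.iterate_succ_apply]
    exact ih (ContDiff.pderiv hg j)

lemma mderiv_single (j : Fin d) (m : ℕ) (g : (Fin d → ℝ) → ℝ) :
    mderiv d (Pi.single j m) g = (pderiv d j)^[m] g := by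
  have key : ∀ l : List (Fin d), l.Nodup →
      l.foldr (fun i h => (pderiv d i)^[(Pi.single j m : Fin d → ℕ) i] h) g
        = if j ∈ l then (pderiv d j)^[m] g else g := by
    intro l hl
    induction l with
    | nil => simp
    | cons a l ih =>
      obtain ⟨ha, hl⟩ := List.nodup_cons.1 hl
      rw [List.foldr_cons, ih hl]
      rcases eq_or_ne a j with rfl | h
      · simp [ha]
      · simp [h, h.symm]
  simp [mderiv, key _ (List.nodup_finRange d)]

lemma contDiff_phi (k : Fin d → ℤ) : ContDiff ℝ 1 (phi d k) := by
  unfold phi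
  have : ContDiff ℝ 1 (fun x : Fin d → ℝ => ∑ i, (k i : ℂ) * (x i : ℂ)) :=
    ContDiff.sum fun i _ => contDiff_const.mul
      (Complex.ofRealCLM.contDiff.comp (contDiff_apply ℝ ℝ i))
  exact (contDiff_const.mul this).cexp

/-- Integration by parts in the `j`-th coordinate. -/
lemma fCoeff_pderiv {g : (Fin d → ℝ) → ℝ} (hg : ContDiff ℝ 1 g) (j : Fin d)
    (hper : ∀ x ∈ cube d, x j = 1 → g x = g (Function.update x j 0)) (k : Fin d → ℤ) :
    fCoeff d (fun x => (pderiv d j g x : ℂ)) k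
      = 2 * Real.pi * Complex.I * k j * fCoeff d (fun x => (g x : ℂ)) k := by
  obtain ⟨n, rfl⟩ : ∃ n, d = n + 1 := ⟨d - 1, by have := j.pos; omega⟩
  set u : (Fin (n + 1) → ℝ) → ℂ := fun x => (g x : ℂ) * (starRingEnd ℂ) (phi (n + 1) k x) with hu
  have hgc : Continuous fun x => (g x : ℂ) := Complex.continuous_ofReal.comp hg.continuous
  have hpc : Continuous fun x => (pderiv (n + 1) j g x : ℂ) :=
    Complex.continuous_ofReal.comp (ContDiff.pderiv (n := 0) (by simpa using hg) j).continuous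
  have hud : Differentiable ℝ u :=
    (Complex.ofRealCLM.differentiable.comp (hg.differentiable one_ne_zero)).mul
      (Complex.conjCLE.differentiable.comp
        ((contDiff_phi k).differentiable one_ne_zero))
  have hu' : ∀ x, fderiv ℝ u x (Pi.single j 1)
      = (pderiv (n + 1) j g x : ℂ) * (starRingEnd ℂ) (phi (n + 1) k x)
        - 2 * Real.pi * Complex.I * k j * u x := by
    intro x
    have h1 := ((hg.differentiable one_ne_zero x).hasFDerivAt.hasDerivAt_update j).ofReal_comp
    have h2 : HasDerivAt (fun t => (starRingEnd ℂ) (phi (n + 1) k (Function.update x j t)))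
        ((starRingEnd ℂ) (2 * Real.pi * Complex.I * k j * phi (n + 1) k x)) (x j) :=
      Complex.conjCLE.hasFDerivAt.comp_hasDerivAt (x j) (hasDerivAt_phi_update k x j)
    rw [((hud x).hasFDerivAt.hasDerivAt_update j).unique (h1.mul h2),
      pderiv_eq_fderiv (hg.differentiable one_ne_zero), hu]
    simp only [map_mul, Complex.conj_ofReal, Complex.conj_I, map_ofNat, map_intCast,
      Function.update_eq_self]
    ring
  have hface : ∀ x ∈ Set.Icc (0 : Fin n → ℝ) 1,
      u (j.insertNth 1 x) = u (j.insertNth 0 x) := by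
    intro x hx
    have hup : (j.insertNth 0 x : Fin (n + 1) → ℝ)
        = Function.update (j.insertNth 1 x : Fin (n + 1) → ℝ) j 0 := by simp
    have hup1 : (j.insertNth 1 x : Fin (n + 1) → ℝ)
        = Function.update (j.insertNth 1 x : Fin (n + 1) → ℝ) j 1 := by simp
    have hmem : (j.insertNth 1 x : Fin (n + 1) → ℝ) ∈ cube (n + 1) := by
      rw [cube, Fin.insertNth_mem_Icc]
      exact ⟨by simp, hx⟩
    simp only [hu]
    rw [hper _ hmem (by simp), ← hup]
    congr 2
    rw [hup, ← phi_update_one, ← hup1]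
  have hi1 := integrableOn_mul_conj_phi hpc k
  have hi2 := (integrableOn_mul_conj_phi hgc k).const_mul (2 * Real.pi * Complex.I * k j)
  have hsum : ∀ x : Fin (n + 1) → ℝ,
      ∑ i, (if i = j then fderiv ℝ u x else 0) (Pi.single i 1)
        = fderiv ℝ u x (Pi.single j 1) := by
    intro x
    rw [Finset.sum_eq_single j] <;> simp +contextual
  have hdiv := integral_divergence_of_hasFDerivAt_off_countable' (0 : Fin (n + 1) → ℝ) 1
    zero_le_one (fun i => if i = j then u else 0)
    (fun i x => if i = j then fderiv ℝ u x else 0) ∅ Set.countable_empty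
    (fun i => by split_ifs; exacts [hud.continuous.continuousOn, continuousOn_const])
    (fun x _ i => by split_ifs; exacts [(hud x).hasFDerivAt, hasFDerivAt_const 0 x])
    (by simp only [hsum, hu']; exact hi1.sub hi2)
  rw [Finset.sum_eq_single j (by simp +contextual) (by simp)] at hdiv
  simp only [hsum, hu', if_true] at hdiv
  have hdiv := (integral_sub hi1 hi2).symm.trans hdiv
  rw [integral_const_mul] at hdiv
  rw [fCoeff, fCoeff, ← sub_eq_zero]
  refine hdiv.trans (sub_eq_zero.2 ?_)
  exact setIntegral_congr_fun measurableSet_Icc hface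

end Derivatives

section Bias

variable {d β : ℕ} {L : ℝ} {f : (Fin d → ℝ) → ℝ}

lemma single_mem_multiIdx (j : Fin d) : Pi.single j β ∈ multiIdx d β := by
  simp only [multiIdx, Finset.mem_filter, Fintype.mem_piFinset, Finset.mem_range,
    Finset.sum_pi_single', Finset.mem_univ, if_true, and_true]
  intro i
  rcases eq_or_ne i j with rfl | h <;> simp [*]

lemma fCoeff_iterate_pderiv (hf : SobolevP d β L f) (j : Fin d) (k : Fin d → ℤ) {m : ℕ}
    (hm : m ≤ β) :
    fCoeff d (fun x => ((pderiv d j)^[m] f x : ℂ)) k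
      = (2 * Real.pi * Complex.I * k j) ^ m * fCoeff d (fun x => (f x : ℂ)) k := by
  induction m with
  | zero => simp
  | succ m ih =>
    have hsmooth : ContDiff ℝ (1 : ℕ) ((pderiv d j)^[m] f) :=
      ContDiff.iterate_pderiv (hf.1.of_le (by norm_cast; omega)) j
    rw [Function.iterate_succ', Function.comp_def, fCoeff_pderiv (by exact_mod_cast hsmooth),
      ih (by omega), pow_succ']
    · ring
    · intro x hx hxj
      have h := hf.2.2 (Pi.single j m) (by simpa using hm) x hx j (.inr hxj)
      simpa [mderiv_single, hxj] using h

lemma sum_l2sq_iterate_pderiv_le (hβ : 1 ≤ β) (hf : SobolevP d β L f) :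
    ∑ j, l2sq d (fun x => ((pderiv d j)^[β] f x : ℂ)) ≤ L ^ 2 := by
  refine le_trans ?_ hf.2.1
  have hinj : Function.Injective fun j : Fin d => (Pi.single j β : Fin d → ℕ) := by
    intro i j h
    by_contra hij
    have := congrFun h i
    simp [hij] at this
    omega
  calc ∑ j, l2sq d (fun x => ((pderiv d j)^[β] f x : ℂ))
      = ∑ α ∈ Finset.univ.image fun j : Fin d => (Pi.single j β : Fin d → ℕ),
          ∫ x in cube d, (mderiv d α f x) ^ 2 := by
        rw [Finset.sum_image hinj.injOn]
        simp [l2sq, mderiv_single]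
    _ ≤ _ := by
        refine Finset.sum_le_sum_of_subset_of_nonneg ?_ fun α _ _ =>
          integral_nonneg fun x => sq_nonneg _
        simp only [Finset.image_subset_iff, Finset.mem_univ, true_imp_iff]
        exact single_mem_multiIdx

lemma exists_le_abs_of_notMem_box {M : ℕ} {k : Fin d → ℤ} (hk : k ∉ box d M) :
    ∃ j, (M : ℝ) + 1 ≤ |(k j : ℝ)| := by
  simp only [_root_.box, Fintype.mem_piFinset, Finset.mem_Icc, not_forall, ← abs_le, not_le] at hk
  obtain ⟨j, hj⟩ := hk
  exact ⟨j, by exact_mod_cast hj⟩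

end Bias

/-- bias of the rank-`M` projection on the Sobolev ball. If
`f ∈ S_L^p(β)` with `β ≥ 1` then `‖f - f_M‖² ≤ (L² / (2π)^{2β}) (M+1)^{-2β}`. -/
theorem stmt3 (d β : ℕ) (hd : 1 ≤ d) (hβ : 1 ≤ β) (L : ℝ) (hL : 0 < L) (M : ℕ)
    (f : (Fin d → ℝ) → ℝ) (hf : SobolevP d β L f) :
    l2sq d (fun x => (f x : ℂ) - projM d M (fun y => (f y : ℂ)) x)
      ≤ L ^ 2 / (2 * Real.pi) ^ (2 * β) * (((M : ℝ) + 1) ^ (2 * β))⁻¹ := by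
  set A : ℝ := (2 * Real.pi) ^ (2 * β) * ((M : ℝ) + 1) ^ (2 * β) with hA
  have hA0 : 0 < A := by positivity
  have hfc : Continuous fun x => (f x : ℂ) := Complex.continuous_ofReal.comp hf.1.continuous
  have hsum := (hasSum_sq_fCoeff (g := fun x => (f x : ℂ) - projM d M (fun y => (f y : ℂ)) x)
    (hfc.sub (continuous_projM d M _))).mul_left A
  have hder : HasSum (fun k => ∑ j, ‖fCoeff d (fun x => ((pderiv d j)^[β] f x : ℂ)) k‖ ^ 2)
      (∑ j, l2sq d (fun x => ((pderiv d j)^[β] f x : ℂ))) :=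
    hasSum_sum fun j _ => hasSum_sq_fCoeff (Complex.continuous_ofReal.comp
      (ContDiff.iterate_pderiv (n := 0) (hf.1.of_le (by simp)) j).continuous)
  have hle := (hasSum_le (fun k => ?_) hsum hder).trans (sum_l2sq_iterate_pderiv_le hβ hf)
  · rw [← div_eq_mul_inv, div_div, ← hA, le_div_iff₀ hA0, mul_comm]
    exact hle
  · simp only [fCoeff_sub_projM hfc]
    split_ifs with hk
    · simpa using Finset.sum_nonneg fun j _ => sq_nonneg _
    · obtain ⟨j, hj⟩ := exists_le_abs_of_notMem_box hk
      refine le_trans ?_ (Finset.single_le_sum (fun j _ => sq_nonneg _) (Finset.mem_univ j))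
      rw [fCoeff_iterate_pderiv hf j k le_rfl, norm_mul, mul_pow, norm_pow, ← pow_mul,
        mul_comm β 2, hA, ← mul_pow]
      gcongr
      simpa [abs_of_pos Real.pi_pos] using mul_le_mul_of_nonneg_left hj Real.two_pi_pos.le

end
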